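/- Let Θ = Alt(Or₁ ∪ Or₂) : (S¹×S¹)⁵ → ℝ, where Or₁, Or₂ are the pullbacks of the orientation cocycle Or under the two projections, ∪ denotes the standard simplicial cup product of a 2-cochain with a 2-cochain, and Alt denotes alternation over Sym(5). Then for every 5-tuple z in (S¹×S¹)⁵, |Θ(z)| ≤ 2/3. -/

import Mathlib

open scoped BigOperators

/-- Orientation cocycle on the circle: +1 for positively oriented (counterclockwise)
triples of distinct points, -1 for negatively oriented triples, 0 if two coincide. -/
noncomputable def orient (a b c : Circle) : ℝ :=
  Real.sign (((starRingEnd ℂ) ((b : ℂ) - (a : ℂ)) * ((c : ℂ) - (a : ℂ))).im)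

/-- `x 0, …, x (n-1)` are positively cyclically ordered according to their numbering. -/
def PosCyclicallyOrdered {n : ℕ} (x : Fin n → Circle) : Prop :=
  ∀ i j k : Fin n, i < j → j < k → orient (x i) (x j) (x k) = 1

/-- Θ = Alt(Or₁ ∪ Or₂). -/
noncomputable def Theta (z : Fin 5 → Circle × Circle) : ℝ :=
  (1 / 120) * ∑ σ : Equiv.Perm (Fin 5),
    ((Equiv.Perm.sign σ : ℤ) : ℝ) *
      (orient (z (σ 0)).1 (z (σ 1)).1 (z (σ 2)).1 *
        orient (z (σ 2)).2 (z (σ 3)).2 (z (σ 4)).2)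


namespace ThetaBound

/-- Integer-valued comparison sign. -/
def sg {α : Type} [LinearOrder α] (a b : α) : ℤ := if a < b then 1 else if b < a then -1 else 0

/-- Orientation of a triple of linearly ordered labels. -/
def cyc {α : Type} [LinearOrder α] (a b c : α) : ℤ := sg a b * sg a c * sg b c

abbrev Key := ℤ × Fin 5 × Fin 5 × Fin 5 × Fin 5 × Fin 5

def key (σ : Equiv.Perm (Fin 5)) : Key :=
  ((Equiv.Perm.sign σ : ℤ), σ 0, σ 1, σ 2, σ 3, σ 4)

def base : List Key :=
  [(1, 0, 1, 2, 3, 4), (-1, 0, 2, 1, 3, 4), (1, 0, 3, 1, 2, 4), (-1, 0, 4, 1, 2, 3),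
   (1, 1, 2, 0, 3, 4), (-1, 1, 3, 0, 2, 4), (1, 1, 4, 0, 2, 3),
   (1, 2, 3, 0, 1, 4), (-1, 2, 4, 0, 1, 3), (1, 3, 4, 0, 1, 2)]

def rot : Key → List Key := fun (s, a, b, i, j, k) =>
  [(s, a, b, i, j, k), (s, a, b, j, k, i), (s, a, b, k, i, j)]

def swp : Key → List Key := fun (s, a, b, i, j, k) =>
  [(s, a, b, i, j, k), (-s, b, a, i, j, k), (-s, a, b, i, k, j), (s, b, a, i, k, j)]

theorem keys_eq : (Finset.univ : Finset (Equiv.Perm (Fin 5))).val.map key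
    = ((base.flatMap rot).flatMap swp : List Key) := by
  decide +kernel

def tm (f g : Fin 5 → Fin 5 → Fin 5 → ℤ) : Key → ℤ := fun (s, a, b, i, j, k) =>
  s * (f a b i * g i j k)

def tm3 (f g : Fin 5 → Fin 5 → Fin 5 → ℤ) : Key → ℤ := fun (s, a, b, i, j, k) =>
  s * ((f a b i + f a b j + f a b k) * g i j k)

theorem sum_flatMap {α β : Type} (l : List α) (h : α → List β) (F : β → ℤ) :
    ((l.flatMap h).map F).sum = (l.map fun x => ((h x).map F).sum).sum := by
  induction l with
  | nil => rfl
  | cons a l ih => simp [List.flatMap_cons, ih]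

theorem sum_perm (f g : Fin 5 → Fin 5 → Fin 5 → ℤ)
    (hf : ∀ a b c, f b a c = - f a b c) (hg1 : ∀ a b c, g b c a = g a b c)
    (hg2 : ∀ a b c, g a c b = - g a b c) :
    ∑ σ : Equiv.Perm (Fin 5), (Equiv.Perm.sign σ : ℤ) *
      (f (σ 0) (σ 1) (σ 2) * g (σ 2) (σ 3) (σ 4)) = 4 * (base.map (tm3 f g)).sum := by
  have h0 : ∑ σ : Equiv.Perm (Fin 5), (Equiv.Perm.sign σ : ℤ) *
      (f (σ 0) (σ 1) (σ 2) * g (σ 2) (σ 3) (σ 4)) =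
      (((Finset.univ : Finset (Equiv.Perm (Fin 5))).val.map key).map (tm f g)).sum := by
    rw [Multiset.map_map]; rfl
  rw [h0, keys_eq, Multiset.map_coe, Multiset.sum_coe, sum_flatMap]
  have h1 : (fun x => ((swp x).map (tm f g)).sum) = fun x => 4 * tm f g x := by
    funext ⟨s, a, b, i, j, k⟩
    simp only [swp, tm, List.map_cons, List.map_nil, List.sum_cons, List.sum_nil]
    rw [hf a b i, hg2 i j k]; ring
  have h2 : (fun x => ((rot x).map (fun x => 4 * tm f g x)).sum) = fun x => 4 * tm3 f g x := by
    funext ⟨s, a, b, i, j, k⟩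
    simp only [rot, tm, tm3, List.map_cons, List.map_nil, List.sum_cons, List.sum_nil]
    rw [hg1 i j k, ← hg1 k i j]; ring
  rw [h1, sum_flatMap, h2, List.sum_map_mul_left]

/-- Label functions from numbers. -/
def lab (a b c d : ℕ) : Fin 5 → ℕ := ![0, a, b, c, d]

def val (r s : Fin 5 → ℕ) : ℤ :=
  (base.map (tm3 (fun i j k => cyc (r i) (r j) (r k)) (fun i j k => cyc (s i) (s j) (s k)))).sum

/-- Each label is the number of strictly smaller labels. -/
def isRank (s : Fin 5 → ℕ) : Bool :=
  [0, 1, 2, 3, 4].all fun i : Fin 5 =>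
    decide (s i = ([0, 1, 2, 3, 4] : List (Fin 5)).countP fun j => decide (s j < s i))

theorem finite_check : ∀ s1 ∈ [0,1,2,3,4], ∀ s2 ∈ [0,1,2,3,4], ∀ s3 ∈ [0,1,2,3,4],
    ∀ s4 ∈ [0,1,2,3,4], isRank (lab s1 s2 s3 s4) = true →
    ∀ b1 ∈ [0, 1], ∀ b2 ∈ [0, 1], ∀ b3 ∈ [0, 1], ∀ b4 ∈ [0, 1],
    (val (lab b1 (b1+b2) (b1+b2+b3) (b1+b2+b3+b4)) (lab s1 s2 s3 s4)).natAbs ≤ 20 := by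
  decide +kernel

theorem cyc_congr {α β : Type} [LinearOrder α] [LinearOrder β] (u : Fin 5 → α) (v : Fin 5 → β)
    (h : ∀ i j, u i < u j ↔ v i < v j) (i j k : Fin 5) :
    cyc (u i) (u j) (u k) = cyc (v i) (v j) (v k) := by
  simp only [cyc, sg, h]

theorem sg_swap {α : Type} [LinearOrder α] (a b : α) : sg b a = - sg a b := by
  unfold sg
  rcases lt_trichotomy a b with h | h | h
  · simp [h, h.not_gt]
  · simp [h]
  · simp [h, h.not_gt]

/-- Labels of a monotone family: partial sums of bits. -/
theorem exists_bits (t : Fin 5 → ℝ) (ht : Monotone t) :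
    ∃ b1 ∈ [0, 1], ∃ b2 ∈ [0, 1], ∃ b3 ∈ [0, 1], ∃ b4 ∈ [0, 1],
      ∀ i j, t i < t j ↔ lab b1 (b1+b2) (b1+b2+b3) (b1+b2+b3+b4) i
        < lab b1 (b1+b2) (b1+b2+b3) (b1+b2+b3+b4) j := by
  have bit : ∀ x y : ℝ, x ≤ y → ∃ b ∈ [0, 1], (b = 0 ∧ x = y) ∨ (b = 1 ∧ x < y) := by
    intro x y h
    rcases h.eq_or_lt with h | h
    · exact ⟨0, by simp, Or.inl ⟨rfl, h⟩⟩
    · exact ⟨1, by simp, Or.inr ⟨rfl, h⟩⟩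
  obtain ⟨b1, m1, h1⟩ := bit (t 0) (t 1) (ht (by decide))
  obtain ⟨b2, m2, h2⟩ := bit (t 1) (t 2) (ht (by decide))
  obtain ⟨b3, m3, h3⟩ := bit (t 2) (t 3) (ht (by decide))
  obtain ⟨b4, m4, h4⟩ := bit (t 3) (t 4) (ht (by decide))
  refine ⟨b1, m1, b2, m2, b3, m3, b4, m4, ?_⟩
  have mono : StrictMono (fun n : ℕ => n) := strictMono_id
  have key : ∀ i j : Fin 5, i ≤ j → (t i < t j ↔ lab b1 (b1+b2) (b1+b2+b3) (b1+b2+b3+b4) i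
        < lab b1 (b1+b2) (b1+b2+b3) (b1+b2+b3+b4) j) ∧
        lab b1 (b1+b2) (b1+b2+b3) (b1+b2+b3+b4) i
        ≤ lab b1 (b1+b2) (b1+b2+b3) (b1+b2+b3+b4) j := by
    clear m1 m2 m3 m4 mono bit
    intro i j hij
    fin_cases i <;> fin_cases j <;> first
      | exact absurd hij (by decide)
      | (simp only [lab, Fin.zero_eta, Fin.mk_one, Fin.reduceFinMk, Matrix.cons_val]
         constructor
         · rcases h1 with ⟨rfl, h1⟩ | ⟨rfl, h1⟩ <;> rcases h2 with ⟨rfl, h2⟩ | ⟨rfl, h2⟩ <;>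
            rcases h3 with ⟨rfl, h3⟩ | ⟨rfl, h3⟩ <;> rcases h4 with ⟨rfl, h4⟩ | ⟨rfl, h4⟩ <;>
            norm_num <;> linarith
         · omega)
  intro i j
  rcases le_total i j with h | h
  · exact (key i j h).1
  · exact ⟨fun h' => absurd (ht h) (not_le.mpr h'), fun h' => absurd (key j i h).2 (not_le.mpr h')⟩

/-- Rank labels of a family whose value at `0` is minimal. -/
theorem exists_rank (t : Fin 5 → ℝ) (h0 : ∀ i, t 0 ≤ t i) :
    ∃ s1 ∈ [0,1,2,3,4], ∃ s2 ∈ [0,1,2,3,4], ∃ s3 ∈ [0,1,2,3,4], ∃ s4 ∈ [0,1,2,3,4],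
      isRank (lab s1 s2 s3 s4) = true ∧
      ∀ i j, t i < t j ↔ lab s1 s2 s3 s4 i < lab s1 s2 s3 s4 j := by
  let s : Fin 5 → ℕ := fun i => (Finset.univ.filter fun j => t j < t i).card
  have hs0 : s 0 = 0 := by
    simp only [s, Finset.card_eq_zero, Finset.filter_eq_empty_iff]
    intro j _
    exact not_lt.mpr (h0 j)
  have hmem : ∀ i, s i ∈ [0,1,2,3,4] := by
    intro i
    have : s i < 5 := by
      have h1 : (Finset.univ.filter fun j => t j < t i) ⊂ (Finset.univ : Finset (Fin 5)) := by
        rw [Finset.ssubset_univ_iff]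
        intro h
        have := (Finset.mem_filter.mp (h ▸ Finset.mem_univ i)).2
        exact lt_irrefl _ this
      simpa using Finset.card_lt_card h1
    simp only [List.mem_cons, List.not_mem_nil, or_false]
    omega
  have hlt : ∀ i j, t i < t j → s i < s j := by
    intro i j hij
    apply Finset.card_lt_card
    rw [Finset.ssubset_iff_of_subset]
    · exact ⟨i, by simp [hij], by simp⟩
    · intro k hk
      simp only [Finset.mem_filter, Finset.mem_univ, true_and] at hk ⊢
      exact hk.trans hij
  have hle : ∀ i j, t i ≤ t j → s i ≤ s j := by
    intro i j hij
    apply Finset.card_le_card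
    intro k hk
    simp only [Finset.mem_filter, Finset.mem_univ, true_and] at hk ⊢
    exact hk.trans_le hij
  have hiff : ∀ i j, t i < t j ↔ s i < s j := fun i j =>
    ⟨hlt i j, fun h => by
      by_contra h'
      exact absurd (hle j i (not_lt.mp h')) (not_le.mpr h)⟩
  have hlab : lab (s 1) (s 2) (s 3) (s 4) = s := by
    funext i
    fin_cases i <;> simp [lab, hs0]
  refine ⟨s 1, hmem 1, s 2, hmem 2, s 3, hmem 3, s 4, hmem 4, ?_, ?_⟩
  · rw [hlab]
    have hc : ∀ i, s i = ([0, 1, 2, 3, 4] : List (Fin 5)).countP fun j => decide (s j < s i) := by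
      intro i
      have : s i = (Finset.univ.filter fun j => s j < s i).card := by
        conv_lhs => simp only [s]
        simp only [hiff]
      conv_lhs => rw [this]
      rw [Finset.card_filter, Fin.sum_univ_five]
      simp only [List.countP_cons, List.countP_nil, decide_eq_true_eq]
      ring
    unfold isRank
    rw [List.all_eq_true]
    intro i _
    rw [decide_eq_true_eq]
    exact hc i
  · rw [hlab]; exact hiff

theorem val_bound (u v : Fin 5 → ℝ) (hu : Monotone u) (hv : ∀ i, v 0 ≤ v i) :
    |∑ σ : Equiv.Perm (Fin 5), (Equiv.Perm.sign σ : ℤ) *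
      (cyc (u (σ 0)) (u (σ 1)) (u (σ 2)) * cyc (v (σ 2)) (v (σ 3)) (v (σ 4)))| ≤ 80 := by
  obtain ⟨b1, m1, b2, m2, b3, m3, b4, m4, hb⟩ := exists_bits u hu
  obtain ⟨s1, n1, s2, n2, s3, n3, s4, n4, hr, hs⟩ := exists_rank v hv
  have hfin := finite_check s1 n1 s2 n2 s3 n3 s4 n4 hr b1 m1 b2 m2 b3 m3 b4 m4
  have hsum := sum_perm
    (fun i j k => cyc (u i) (u j) (u k)) (fun i j k => cyc (v i) (v j) (v k))
    (fun a b c => by simp only [cyc]; rw [sg_swap (u a) (u b)]; ring)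
    (fun a b c => by
      simp only [cyc]; rw [sg_swap (v a) (v c), sg_swap (v a) (v b)]; ring)
    (fun a b c => by simp only [cyc]; rw [sg_swap (v b) (v c)]; ring)
  rw [hsum]
  simp only [cyc_congr u _ hb, cyc_congr v _ hs]
  unfold val at hfin
  rw [abs_mul]
  have : |(base.map (tm3
      (fun i j k => cyc (lab b1 (b1+b2) (b1+b2+b3) (b1+b2+b3+b4) i)
        (lab b1 (b1+b2) (b1+b2+b3) (b1+b2+b3+b4) j) (lab b1 (b1+b2) (b1+b2+b3) (b1+b2+b3+b4) k))
      (fun i j k => cyc (lab s1 s2 s3 s4 i) (lab s1 s2 s3 s4 j) (lab s1 s2 s3 s4 k)))).sum| ≤ 20 := by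
    rw [Int.abs_eq_natAbs]; exact_mod_cast hfin
  norm_num
  linarith

/-- The orientation of points on the circle through angles. -/
theorem sin_half_sign (d : ℝ) (h1 : -(2 * Real.pi) < d) (h2 : d < 2 * Real.pi) :
    Real.sign (Real.sin (d / 2)) = Real.sign d := by
  rcases lt_trichotomy d 0 with h | h | h
  · rw [Real.sign_of_neg h, Real.sign_of_neg]
    exact Real.sin_neg_of_neg_of_neg_pi_lt (by linarith) (by linarith)
  · simp [h]
  · rw [Real.sign_of_pos h, Real.sign_of_pos]
    exact Real.sin_pos_of_pos_of_lt_pi (by linarith) (by linarith)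

theorem sign_mul (a b : ℝ) : Real.sign (a * b) = Real.sign a * Real.sign b := by
  rcases lt_trichotomy a 0 with ha | ha | ha <;> rcases lt_trichotomy b 0 with hb | hb | hb <;>
    first
    | simp [ha]
    | simp [hb]
    | (simp [Real.sign_of_neg, Real.sign_of_pos, ha, hb, mul_pos_of_neg_of_neg, mul_neg_of_pos_of_neg,
        mul_neg_of_neg_of_pos])

theorem sign_sub (a b : ℝ) : Real.sign (b - a) = (sg a b : ℤ) := by
  unfold sg
  rcases lt_trichotomy a b with h | h | h
  · rw [Real.sign_of_pos (sub_pos.mpr h)]; simp [h]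
  · simp [h]
  · rw [Real.sign_of_neg (sub_neg.mpr h)]; simp [h, h.not_gt]

theorem orient_exp (p α β γ : ℝ) (hα : 0 ≤ α ∧ α < 2 * Real.pi) (hβ : 0 ≤ β ∧ β < 2 * Real.pi)
    (hγ : 0 ≤ γ ∧ γ < 2 * Real.pi) :
    orient (Circle.exp (p + α)) (Circle.exp (p + β)) (Circle.exp (p + γ)) = (cyc α β γ : ℤ) := by
  have hform : ((starRingEnd ℂ) ((Circle.exp (p + β) : ℂ) - (Circle.exp (p + α) : ℂ)) *
      ((Circle.exp (p + γ) : ℂ) - (Circle.exp (p + α) : ℂ))).im =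
      4 * (Real.sin ((β - α) / 2) * Real.sin ((γ - α) / 2) * Real.sin ((γ - β) / 2)) := by
    have e1 : ((starRingEnd ℂ) ((Circle.exp (p + β) : ℂ) - (Circle.exp (p + α) : ℂ)) *
      ((Circle.exp (p + γ) : ℂ) - (Circle.exp (p + α) : ℂ))).im =
        Real.sin ((p + γ) - (p + β)) + Real.sin ((p + β) - (p + α))
          - Real.sin ((p + γ) - (p + α)) := by
      simp only [Circle.coe_exp, Complex.mul_im, Complex.conj_re, Complex.conj_im, Complex.sub_re,
        Complex.sub_im, Complex.exp_ofReal_mul_I_re, Complex.exp_ofReal_mul_I_im, Real.sin_sub]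
      ring
    rw [e1]
    have a1 : (p + γ) - (p + β) = 2 * ((γ - β) / 2) := by ring
    have a2 : (p + β) - (p + α) = 2 * ((β - α) / 2) := by ring
    have a3 : (p + γ) - (p + α) = 2 * ((γ - β) / 2 + (β - α) / 2) := by ring
    have a4 : (γ - α) / 2 = (γ - β) / 2 + (β - α) / 2 := by ring
    rw [a1, a2, a3, a4]
    generalize (γ - β) / 2 = x
    generalize (β - α) / 2 = y
    rw [Real.sin_two_mul, Real.sin_two_mul, Real.sin_two_mul, Real.sin_add, Real.cos_add]
    have hx := Real.sin_sq_add_cos_sq x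
    have hy := Real.sin_sq_add_cos_sq y
    have cx : Real.cos x ^ 2 = 1 - Real.sin x ^ 2 := by linarith
    have cy : Real.cos y ^ 2 = 1 - Real.sin y ^ 2 := by linarith
    ring_nf
    simp only [cx, cy]
    ring
  unfold orient
  rw [hform, sign_mul, sign_mul, sign_mul, sin_half_sign, sin_half_sign, sin_half_sign,
    sign_sub, sign_sub, sign_sub, Real.sign_of_pos (by norm_num : (0 : ℝ) < 4)]
  · simp [cyc]
  all_goals linarith

/-- Angles of a family of points, measured from the point with index `0`. -/
theorem exists_angles (x : Fin 5 → Circle) : ∃ t : Fin 5 → ℝ, (∀ i, t 0 ≤ t i) ∧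
    ∀ i j k, orient (x i) (x j) (x k) = (cyc (t i) (t j) (t k) : ℤ) := by
  have hpi := Real.pi_pos
  let a : Fin 5 → ℝ := fun i => Complex.arg (x i / x 0 : Circle)
  let t : Fin 5 → ℝ := fun i => if a i < 0 then a i + 2 * Real.pi else a i
  have ht : ∀ i, 0 ≤ t i ∧ t i < 2 * Real.pi := by
    intro i
    have h1 : -Real.pi < a i := Complex.neg_pi_lt_arg _
    have h2 : a i ≤ Real.pi := Complex.arg_le_pi _
    simp only [t]
    split_ifs with h <;> constructor <;> linarith
  have hx : ∀ i, x i = Circle.exp (Complex.arg (x 0) + t i) := by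
    intro i
    have h1 : Circle.exp (t i) = x i / x 0 := by
      have h2 : Circle.exp (a i) = x i / x 0 := Circle.exp_arg _
      simp only [t]
      split_ifs
      · rw [Circle.exp_add, Circle.exp_two_pi, mul_one, h2]
      · exact h2
    rw [Circle.exp_add, Circle.exp_arg, h1, mul_div_cancel]
  refine ⟨t, ?_, ?_⟩
  · intro i
    have : t 0 = 0 := by simp [t, a]
    rw [this]; exact (ht i).1
  · intro i j k
    rw [hx i, hx j, hx k]
    exact orient_exp _ _ _ _ (ht i) (ht j) (ht k)

theorem Theta_comp (z : Fin 5 → Circle × Circle) (τ : Equiv.Perm (Fin 5)) :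
    |Theta (z ∘ τ)| = |Theta z| := by
  have h : Theta (z ∘ τ) = ((Equiv.Perm.sign τ : ℤ) : ℝ) * Theta z := by
    unfold Theta
    rw [mul_left_comm]
    congr 1
    conv_rhs => rw [← Equiv.sum_comp (Equiv.mulLeft τ), Finset.mul_sum]
    apply Finset.sum_congr rfl
    intro σ _
    have hs : ((Equiv.Perm.sign τ : ℤ) : ℝ) * ((Equiv.Perm.sign τ : ℤ) : ℝ) = 1 := by
      rcases Int.units_eq_one_or (Equiv.Perm.sign τ) with h | h <;> simp [h]
    simp only [Equiv.coe_mulLeft, Equiv.Perm.sign_mul, Units.val_mul, Int.cast_mul,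
      Equiv.Perm.mul_apply, Function.comp]
    rw [mul_assoc (_ : ℝ) _ (_ * _), ← mul_assoc _ _ (_ * (_ * _)), hs, one_mul]
  rw [h, abs_mul]
  rcases Int.units_eq_one_or (Equiv.Perm.sign τ) with h | h <;> simp [h]

end ThetaBound

/-- `|Θ| ≤ 2/3` on every 5-tuple of points of `S¹ × S¹`. -/
theorem theta_le_two_thirds (z : Fin 5 → Circle × Circle) : |Theta z| ≤ 2 / 3 := by
  obtain ⟨t, -, ht⟩ := ThetaBound.exists_angles (fun i => (z i).1)
  obtain ⟨v, hv0, hv⟩ := ThetaBound.exists_angles (fun i => ((z ∘ Tuple.sort t) i).2)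
  have hb := ThetaBound.val_bound (t ∘ Tuple.sort t) v (Tuple.monotone_sort t) hv0
  rw [← ThetaBound.Theta_comp z (Tuple.sort t)]
  have hu : ∀ i j k, orient ((z ∘ Tuple.sort t) i).1 ((z ∘ Tuple.sort t) j).1
      ((z ∘ Tuple.sort t) k).1 = (ThetaBound.cyc ((t ∘ Tuple.sort t) i) ((t ∘ Tuple.sort t) j)
        ((t ∘ Tuple.sort t) k) : ℤ) := fun i j k => ht _ _ _
  unfold Theta
  simp only [hu, hv]
  have hb' := (Int.cast_le (R := ℝ)).mpr hb
  rw [Int.cast_abs] at hb'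
  push_cast at hb'
  rw [abs_mul, abs_of_pos (by norm_num : (0 : ℝ) < 1 / 120)]
  linarith
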